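/- Let Φ = (m ⊗ id)(id ⊗ Δ̲): A⊗A → A⊗A. Then Φ² = id + Δ(1)·(ε∘μ); that is, for all u, v ∈ A, Φ(Φ(u⊗v)) = u⊗v + ε(uv)·Δ(1). -/

import Mathlib

open Polynomial TensorProduct

noncomputable section

/-- The base ring `R = ℤ[a,b,c]`, the polynomial ring in three variables over `ℤ`. -/
abbrev R3 : Type := MvPolynomial (Fin 3) ℤ

/-- The variable `a ∈ ℤ[a,b,c]`. -/
def va : R3 := MvPolynomial.X 0
/-- The variable `b ∈ ℤ[a,b,c]`. -/
def vb : R3 := MvPolynomial.X 1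
/-- The variable `c ∈ ℤ[a,b,c]`. -/
def vc : R3 := MvPolynomial.X 2

/-- The polynomial `X³ − aX² − bX − c` over `ℤ[a,b,c]`. -/
def f3 : R3[X] := X ^ 3 - C va * X ^ 2 - C vb * X - C vc

/-- The algebra `A = ℤ[a,b,c][X]/(X³ − aX² − bX − c)`, a free `R3`-module
with basis `{1, X, X²}`. -/
abbrev A3 : Type := AdjoinRoot f3

/-- The image `X ∈ A` of the polynomial variable. -/
def x3 : A3 := AdjoinRoot.root f3

/-- The element `Δ(1) = −(1⊗X² + X⊗X + X²⊗1) + a(1⊗X + X⊗1) + b(1⊗1) ∈ A ⊗_R A`. -/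
def D1 : A3 ⊗[R3] A3 :=
  -((1 : A3) ⊗ₜ[R3] (x3 ^ 2) + x3 ⊗ₜ[R3] x3 + (x3 ^ 2) ⊗ₜ[R3] (1 : A3))
    + va • ((1 : A3) ⊗ₜ[R3] x3 + x3 ⊗ₜ[R3] (1 : A3))
    + vb • ((1 : A3) ⊗ₜ[R3] (1 : A3))

/-- The table of theta values on basis elements `(X^i, X^j, X^k)`:
`θ(1,X,X²) = θ(X²,1,X) = θ(X,X²,1) = 1`, `θ(1,X²,X) = θ(X,1,X²) = θ(X²,X,1) = −1`,
and `θ = 0` on all other triples of basis elements. -/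
def tv (i j k : Fin 3) : R3 :=
  if (i, j, k) = ((0 : Fin 3), (1 : Fin 3), (2 : Fin 3)) ∨
      (i, j, k) = ((2 : Fin 3), (0 : Fin 3), (1 : Fin 3)) ∨
      (i, j, k) = ((1 : Fin 3), (2 : Fin 3), (0 : Fin 3)) then 1
  else if (i, j, k) = ((0 : Fin 3), (2 : Fin 3), (1 : Fin 3)) ∨
      (i, j, k) = ((1 : Fin 3), (0 : Fin 3), (2 : Fin 3)) ∨
      (i, j, k) = ((2 : Fin 3), (1 : Fin 3), (0 : Fin 3)) then -1
  else 0

/-- The branch-curve bracket `[u,v] = Σ θ(1₍₁₎, u, v) · 1₍₂₎`, obtained by contracting the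
explicit element `Δ(1) = −(1⊗X² + X⊗X + X²⊗1) + a(1⊗X + X⊗1) + b(1⊗1)` against the
trilinear form `θ` in its first tensor factor. -/
def br (θ : A3 →ₗ[R3] A3 →ₗ[R3] A3 →ₗ[R3] R3) (u v : A3) : A3 :=
  -(θ 1 u v • x3 ^ 2 + θ x3 u v • x3 + θ (x3 ^ 2) u v • (1 : A3))
    + va • (θ 1 u v • x3 + θ x3 u v • (1 : A3))
    + vb • (θ 1 u v • (1 : A3))

/-- The branch-curve comultiplication `Δ̲(v) = Σ [v, 1₍₁₎] ⊗ 1₍₂₎`, obtained from the explicit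
element `Δ(1) = −(1⊗X² + X⊗X + X²⊗1) + a(1⊗X + X⊗1) + b(1⊗1)`. -/
def Dl (θ : A3 →ₗ[R3] A3 →ₗ[R3] A3 →ₗ[R3] R3) (v : A3) : A3 ⊗[R3] A3 :=
  -((br θ v 1) ⊗ₜ[R3] (x3 ^ 2) + (br θ v x3) ⊗ₜ[R3] x3 + (br θ v (x3 ^ 2)) ⊗ₜ[R3] (1 : A3))
    + va • ((br θ v 1) ⊗ₜ[R3] x3 + (br θ v x3) ⊗ₜ[R3] (1 : A3))
    + vb • ((br θ v 1) ⊗ₜ[R3] (1 : A3))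

/-- The composite `(m ⊗ id)(id ⊗ Δ̲)` on pure tensors:
`Φ(u ⊗ v) = Σ [u, v₍₍₁₎₎] ⊗ v₍₍₂₎₎`, where `Δ̲(v) = Σ v₍₍₁₎₎ ⊗ v₍₍₂₎₎ = Σ [v,1₍₁₎] ⊗ 1₍₂₎`. -/
def Phi (θ : A3 →ₗ[R3] A3 →ₗ[R3] A3 →ₗ[R3] R3) (u v : A3) : A3 ⊗[R3] A3 :=
  -((br θ u (br θ v 1)) ⊗ₜ[R3] (x3 ^ 2) + (br θ u (br θ v x3)) ⊗ₜ[R3] x3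
      + (br θ u (br θ v (x3 ^ 2))) ⊗ₜ[R3] (1 : A3))
    + va • ((br θ u (br θ v 1)) ⊗ₜ[R3] x3 + (br θ u (br θ v x3)) ⊗ₜ[R3] (1 : A3))
    + vb • ((br θ u (br θ v 1)) ⊗ₜ[R3] (1 : A3))

theorem x3_pow_three : x3 ^ 3 = va • x3 ^ 2 + vb • x3 + vc • (1 : A3) := by
  have h : aeval x3 (X ^ 3 - C va * X ^ 2 - C vb * X - C vc) = 0 := by
    change aeval (AdjoinRoot.root f3) f3 = 0
    rw [AdjoinRoot.aeval_eq, AdjoinRoot.mk_self]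
  simp only [map_sub, map_mul, map_pow, aeval_X, aeval_C] at h
  simp only [Algebra.smul_def, mul_one]
  linear_combination h

theorem exists_coords (u : A3) :
    ∃ p q r : R3, u = p • (1 : A3) + q • x3 + r • x3 ^ 2 := by
  induction u using AdjoinRoot.induction_on with
  | ih g =>
    induction g using Polynomial.induction_on with
    | C t =>
      refine ⟨t, 0, 0, ?_⟩
      simp [Algebra.smul_def]
    | add g h hg hh =>
      obtain ⟨p, q, r, hg⟩ := hg
      obtain ⟨p', q', r', hh⟩ := hh
      refine ⟨p + p', q + q', r + r', ?_⟩
      rw [map_add, hg, hh]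
      module
    | monomial n t h =>
      obtain ⟨p, q, r, h⟩ := h
      refine ⟨r * vc, p + r * vb, q + r * va, ?_⟩
      have hx : x3 * x3 ^ 2 = va • x3 ^ 2 + vb • x3 + vc • (1 : A3) := by
        rw [← x3_pow_three]; ring
      rw [pow_succ, ← mul_assoc, map_mul, h, AdjoinRoot.mk_X, mul_comm]
      change x3 * _ = _
      simp only [mul_add, mul_smul_comm, hx, mul_one, ← sq]
      module

theorem tensor_map_ext {M : Type*} [AddCommGroup M] [Module R3 M]
    {F G : A3 ⊗[R3] A3 →ₗ[R3] M}
    (h : ∀ i j : Fin 3, F ((x3 ^ (i : ℕ)) ⊗ₜ[R3] (x3 ^ (j : ℕ))) =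
      G ((x3 ^ (i : ℕ)) ⊗ₜ[R3] (x3 ^ (j : ℕ)))) : F = G := by
  refine TensorProduct.ext' fun u v => ?_
  obtain ⟨p, q, r, rfl⟩ := exists_coords u
  obtain ⟨p', q', r', rfl⟩ := exists_coords v
  simp only [Fin.forall_fin_succ, Fin.val_zero, Fin.val_succ, pow_zero, zero_add, pow_one,
    Nat.reduceAdd, IsEmpty.forall_iff, and_true] at h
  obtain ⟨⟨h00, h01, h02⟩, ⟨h10, h11, h12⟩, h20, h21, h22⟩ := h
  simp only [TensorProduct.add_tmul, TensorProduct.tmul_add, ← TensorProduct.smul_tmul',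
    TensorProduct.tmul_smul, map_add, map_smul, h00, h01, h02, h10, h11, h12, h20, h21, h22]

theorem br_add_right (θ : A3 →ₗ[R3] A3 →ₗ[R3] A3 →ₗ[R3] R3) (u v w : A3) :
    br θ u (v + w) = br θ u v + br θ u w := by
  simp only [br, map_add]; module

theorem br_smul_right (θ : A3 →ₗ[R3] A3 →ₗ[R3] A3 →ₗ[R3] R3) (t : R3) (u v : A3) :
    br θ u (t • v) = t • br θ u v := by
  simp only [br, map_smul, smul_eq_mul]; module

theorem br_neg_right (θ : A3 →ₗ[R3] A3 →ₗ[R3] A3 →ₗ[R3] R3) (u v : A3) :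
    br θ u (-v) = -br θ u v := by
  simp only [br, map_neg]; module

theorem br_sub_right (θ : A3 →ₗ[R3] A3 →ₗ[R3] A3 →ₗ[R3] R3) (u v w : A3) :
    br θ u (v - w) = br θ u v - br θ u w := by
  simp only [br, map_sub]; module

theorem br_zero_right (θ : A3 →ₗ[R3] A3 →ₗ[R3] A3 →ₗ[R3] R3) (u : A3) : br θ u 0 = 0 := by
  simp [br]

/-- The composite `(m ⊗ id)(id ⊗ Δ̲)` is the flip minus `Δ(1)·(ε∘μ)`. -/
theorem Phi_eq_flip_sub (ε : A3 →ₗ[R3] R3)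
    (hε1 : ε 1 = 0) (hεx : ε x3 = 0) (hεx2 : ε (x3 ^ 2) = -1)
    (θ : A3 →ₗ[R3] A3 →ₗ[R3] A3 →ₗ[R3] R3)
    (hθ : ∀ i j k : Fin 3, θ (x3 ^ (i : ℕ)) (x3 ^ (j : ℕ)) (x3 ^ (k : ℕ)) = tv i j k)
    (Φ : A3 ⊗[R3] A3 →ₗ[R3] A3 ⊗[R3] A3)
    (hΦ : ∀ u v : A3, Φ (u ⊗ₜ[R3] v) = Phi θ u v) (u v : A3) :
    Φ (u ⊗ₜ[R3] v) = v ⊗ₜ[R3] u - ε (u * v) • D1 := by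
  have hεx3 : ε (x3 ^ 3) = -va := by
    simp [x3_pow_three, hε1, hεx, hεx2]
  have hεx4 : ε (x3 ^ 4) = -va ^ 2 - vb := by
    have h : x3 ^ 4 = va • x3 ^ 3 + vb • x3 ^ 2 + vc • x3 := by
      rw [pow_succ x3 3]
      nth_rewrite 1 [x3_pow_three]
      simp only [add_mul, smul_mul_assoc, one_mul, ← sq, ← pow_succ, Nat.reduceAdd]
    simp only [h, map_add, map_smul, hεx3, hεx, hεx2, smul_eq_mul]
    ring
  simp only [Fin.forall_fin_succ, Fin.val_zero, Fin.val_succ, pow_zero, zero_add, pow_one,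
    Nat.reduceAdd, IsEmpty.forall_iff, and_true] at hθ
  simp [tv] at hθ
  have b00 : br θ (1 : A3) (1 : A3) = 0 := by
    simp only [br, hθ]; module
  have b01 : br θ (1 : A3) x3 = -(1 : A3) := by
    simp only [br, hθ]; module
  have b02 : br θ (1 : A3) (x3 ^ 2) = x3 - va • (1 : A3) := by
    simp only [br, hθ]; module
  have b10 : br θ x3 (1 : A3) = 1 := by
    simp only [br, hθ]; module
  have b11 : br θ x3 x3 = 0 := by
    simp only [br, hθ]; module
  have b12 : br θ x3 (x3 ^ 2) = va • x3 + vb • (1 : A3) - x3 ^ 2 := by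
    simp only [br, hθ]; module
  have b20 : br θ (x3 ^ 2) (1 : A3) = va • (1 : A3) - x3 := by
    simp only [br, hθ]; module
  have b21 : br θ (x3 ^ 2) x3 = x3 ^ 2 - va • x3 - vb • (1 : A3) := by
    simp only [br, hθ]; module
  have b22 : br θ (x3 ^ 2) (x3 ^ 2) = 0 := by
    simp only [br, hθ]; module
  suffices h : Φ = (TensorProduct.comm R3 A3 A3).toLinearMap -
      (LinearMap.toSpanSingleton R3 _ D1) ∘ₗ ε ∘ₗ LinearMap.mul' R3 A3 by
    simpa using LinearMap.congr_fun h (u ⊗ₜ v)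
  refine tensor_map_ext fun i j => ?_
  simp only [LinearMap.sub_apply, LinearMap.comp_apply, LinearEquiv.coe_coe,
    TensorProduct.comm_tmul, LinearMap.mul'_apply, LinearMap.toSpanSingleton_apply, ← pow_add, hΦ]
  fin_cases i <;> fin_cases j <;>
  · simp only [pow_zero, pow_one, Nat.reduceAdd, hε1, hεx, hεx2, hεx3, hεx4, D1, Phi, b00, b01, b02, b10,
      b11, b12, b20, b21, b22, br_add_right, br_sub_right, br_smul_right, br_neg_right,
      br_zero_right, TensorProduct.sub_tmul, TensorProduct.add_tmul, TensorProduct.neg_tmul,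
      TensorProduct.zero_tmul, ← TensorProduct.smul_tmul']
    module

/-- The skein relation `Φ² = id + Δ(1)·(ε∘μ)` for `Φ = (m ⊗ id)(id ⊗ Δ̲)`: for all `u, v ∈ A`,
`Φ(Φ(u⊗v)) = u⊗v + ε(uv)·Δ(1)`. -/
theorem skein_relation_second (ε : A3 →ₗ[R3] R3)
    (hε1 : ε 1 = 0) (hεx : ε x3 = 0) (hεx2 : ε (x3 ^ 2) = -1)
    (θ : A3 →ₗ[R3] A3 →ₗ[R3] A3 →ₗ[R3] R3)
    (hθ : ∀ i j k : Fin 3, θ (x3 ^ (i : ℕ)) (x3 ^ (j : ℕ)) (x3 ^ (k : ℕ)) = tv i j k)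
    (Φ : A3 ⊗[R3] A3 →ₗ[R3] A3 ⊗[R3] A3)
    (hΦ : ∀ u v : A3, Φ (u ⊗ₜ[R3] v) = Phi θ u v) :
    ∀ u v : A3, Φ (Φ (u ⊗ₜ[R3] v)) = u ⊗ₜ[R3] v + ε (u * v) • D1 := by
  intro u v
  have h := Phi_eq_flip_sub ε hε1 hεx hεx2 θ hθ Φ hΦ
  have hD : Φ D1 = (-2 : R3) • D1 := by
    simp only [D1, map_add, map_neg, map_smul, h, one_mul, mul_one, ← sq x3, hε1, hεx, hεx2]
    module
  rw [h, map_sub, map_smul, hD, h, mul_comm v u]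
  module
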